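/- Let (A, L) be an extended complete spectral metric space, F = (f_1, …, f_k) a dual IFS on A, and π weights with dilupsum(π·F*) < 1. Suppose there exists a state φ₀ on A with d_L(φ₀, (π·F*)(φ₀)) < ∞. Then the sequence of states ((π·F*)^M(φ₀))_{M=0}^∞ is d_L-convergent, and its d_L-limit is a (π·F*)-self-similar state; in particular at least one (π·F*)-self-similar state exists. -/

import Mathlib

open Filter Topology
open scoped ComplexOrder ENNReal NNReal MultiplierAlgebra

noncomputable section

/-- A *state* on a C⋆-algebra: a continuous linear functional into `ℂ` that is nonnegative
on nonnegative elements and has norm `1`. -/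
def IsState {E : Type*} [NormedAddCommGroup E] [NormedSpace ℂ E] [PartialOrder E]
    (φ : E →L[ℂ] ℂ) : Prop :=
  (∀ a : E, 0 ≤ a → 0 ≤ φ a) ∧ ‖φ‖ = 1

variable {A : Type*} [NonUnitalCStarAlgebra A] [PartialOrder A] [StarOrderedRing A]

/-- `L` is an extended seminorm on the self-adjoint part `A_sa` of `A`:
`L (t • b) = |t| * L b` for real `t`, and `L (b + b') ≤ L b + L b'`. -/
def IsESeminorm (L : selfAdjoint A → ℝ≥0∞) : Prop :=
  (∀ (t : ℝ) (b : selfAdjoint A), L (t • b) = (‖t‖₊ : ℝ≥0∞) * L b) ∧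
    ∀ b b' : selfAdjoint A, L (b + b') ≤ L b + L b'

/-- The spectral distance `d_L(φ, ψ) = sup { |φ b - ψ b| : b ∈ A_sa, L b ≤ 1 }`,
valued in `[0, ∞]`. -/
def dL (L : selfAdjoint A → ℝ≥0∞) (φ ψ : A → ℂ) : ℝ≥0∞ :=
  ⨆ b : {b : selfAdjoint A // L b ≤ 1}, (‖φ (b.1 : A) - ψ (b.1 : A)‖₊ : ℝ≥0∞)

/-- An approximate identity for `A`: a net `(I n)` with `0 ≤ I n`, `‖I n‖ ≤ 1`, and
`‖I n * a - a‖ → 0`, `‖a * I n - a‖ → 0` for every `a : A`. -/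
def IsApproxUnit {ι : Type*} [Preorder ι] (I : ι → A) : Prop :=
  (∀ n, 0 ≤ I n) ∧ (∀ n, ‖I n‖ ≤ 1) ∧
    ∀ a : A, Tendsto (fun n => ‖I n * a - a‖) atTop (𝓝 0) ∧
      Tendsto (fun n => ‖a * I n - a‖) atTop (𝓝 0)

/-- A (self-adjoint valued) approximate identity `(I n)` for `A` along which `L` tends to `0`. -/
structure SpectralAUData (L : selfAdjoint A → ℝ≥0∞) where
  ι : Type
  [pre : Preorder ι]
  [ne : Nonempty ι]
  [dir : IsDirected ι (· ≤ ·)]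
  I : ι → selfAdjoint A
  isAU : IsApproxUnit fun n => (I n : A)
  tendsto_L : Tendsto (fun n => L (I n)) atTop (𝓝 0)

/-- `(A, L)` is an extended complete spectral metric space: the finite-`L` self-adjoint
elements are dense, there is an approximate identity along which `L` tends to `0`, and
`L` is norm-lower semicontinuous. -/
structure IsECSMS (L : selfAdjoint A → ℝ≥0∞) : Prop where
  seminorm : IsESeminorm L
  dense_finite : Dense {b : selfAdjoint A | L b < ⊤}
  lsc : LowerSemicontinuous L
  approxUnit : Nonempty (SpectralAUData L)

/-- A witness that the `*`-homomorphism `f : A → A` is proper: an approximate identity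
whose image under `f` is again an approximate identity. -/
structure ProperWitness (f : A →⋆ₙₐ[ℂ] A) where
  ι : Type
  [pre : Preorder ι]
  [ne : Nonempty ι]
  [dir : IsDirected ι (· ≤ ·)]
  I : ι → A
  isAU : IsApproxUnit I
  isAU_map : IsApproxUnit fun n => f (I n)

/-- A `*`-homomorphism `f : A → A` is proper if there is an approximate identity `(I n)`
for `A` such that `(f (I n))` is again an approximate identity for `A`. -/
def IsProperHom (f : A →⋆ₙₐ[ℂ] A) : Prop := Nonempty (ProperWitness f)

/-- The upper dilation factor `dilup f = sup { L (f b) : b ∈ A_sa, L b ≤ 1 }`. -/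
def dilup (L : selfAdjoint A → ℝ≥0∞) (f : A →⋆ₙₐ[ℂ] A) : ℝ≥0∞ :=
  ⨆ b : {b : selfAdjoint A // L b ≤ 1}, L ⟨f (b.1 : A), b.1.2.map f⟩

/-- The dual operator `(π·F*) φ = Σ_i π_i (φ ∘ f_i)` acting on `ℂ`-valued functionals. -/
def piF {k : ℕ} (f : Fin k → A →⋆ₙₐ[ℂ] A) (π : Fin k → ℝ≥0) (φ : A → ℂ) : A → ℂ :=
  fun a => ∑ i, ((π i : ℝ) : ℂ) * φ (f i a)

/-- For a finite word `ω = (ω 0, …, ω (M-1))`, the composite `f_ω = f_{ω 0} ∘ … ∘ f_{ω (M-1)}`. -/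
def wordMapF {k : ℕ} (f : Fin k → A →⋆ₙₐ[ℂ] A) : (M : ℕ) → (Fin M → Fin k) → A → A
  | 0, _, a => a
  | M + 1, ω, a => wordMapF f M (fun i => ω i.castSucc) (f (ω (Fin.last M)) a)

omit [StarOrderedRing A] in
theorem IsApproxUnit.tendsto_mul_right {ι : Type*} [Preorder ι] {I : ι → A}
    (hI : IsApproxUnit I) (a : A) : Tendsto (fun n => I n * a) atTop (𝓝 a) :=
  tendsto_iff_norm_sub_tendsto_zero.2 (hI.2.2 a).1

/-- A positive element of the unit ball dominates its square. -/
theorem mul_self_le_self_of_norm_le_one {e : A} (he : 0 ≤ e) (he1 : ‖e‖ ≤ 1) : e * e ≤ e := by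
  set s := CFC.sqrt e
  have hs : s * s = e := CFC.sqrt_mul_sqrt_self e he
  have hs' : star s = s := (CFC.sqrt_nonneg e).isSelfAdjoint.star_eq
  calc e * e = star s * e * s := by rw [hs', ← hs]; simp only [mul_assoc]
    _ ≤ ‖e‖ • (star s * s) := CStarAlgebra.star_left_conjugate_le_norm_smul
    _ = ‖e‖ • e := by rw [hs', hs]
    _ ≤ (1 : ℝ) • e := smul_le_smul_of_nonneg_right he1 he
    _ = e := one_smul _ _

/-- The Cauchy–Schwarz inequality for a positive functional. -/
theorem norm_sq_apply_mul_le {φ : A →L[ℂ] ℂ} (hφ : ∀ a : A, 0 ≤ a → 0 ≤ φ a) {e : A}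
    (he : 0 ≤ e) (he1 : ‖e‖ ≤ 1) (a : A) :
    ‖φ (e * a)‖ ^ 2 ≤ ‖φ e‖ * (‖φ‖ * ‖a‖ ^ 2) := by
  let p : A →ₚ[ℂ] ℂ := PositiveLinearMap.mk₀ φ.toLinearMap hφ
  have hp : ∀ x, p x = φ x := fun _ => rfl
  have hsq : ∀ x : A, ‖p.toPreGNS x‖ ^ 2 ≤ ‖φ (star x * x)‖ := by
    intro x
    have h := congrArg norm (p.preGNS_norm_sq (p.toPreGNS x))
    rw [p.ofPreGNS_toPreGNS, hp] at h
    rw [← h]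
    simp
  have hcs := norm_inner_le_norm (𝕜 := ℂ) (p.toPreGNS e) (p.toPreGNS a)
  rw [p.preGNS_inner_def, p.ofPreGNS_toPreGNS, p.ofPreGNS_toPreGNS, hp,
    he.isSelfAdjoint.star_eq] at hcs
  have hee : ‖φ (star e * e)‖ ≤ ‖φ e‖ := by
    rw [he.isSelfAdjoint.star_eq]
    have h0 : 0 ≤ φ (e * e) := by
      simpa [he.isSelfAdjoint.star_eq] using hφ _ (star_mul_self_nonneg e)
    have h1 : φ (e * e) ≤ φ e := by
      have := hφ _ (sub_nonneg.2 (mul_self_le_self_of_norm_le_one he he1))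
      rwa [map_sub, sub_nonneg] at this
    exact CStarAlgebra.norm_le_norm_of_nonneg_of_le h0 h1
  have haa : ‖φ (star a * a)‖ ≤ ‖φ‖ * ‖a‖ ^ 2 := by
    refine (φ.le_opNorm _).trans_eq ?_
    rw [CStarRing.norm_star_mul_self, sq]
  calc ‖φ (e * a)‖ ^ 2 ≤ (‖p.toPreGNS e‖ * ‖p.toPreGNS a‖) ^ 2 := by gcongr
    _ = ‖p.toPreGNS e‖ ^ 2 * ‖p.toPreGNS a‖ ^ 2 := mul_pow _ _ _
    _ ≤ ‖φ e‖ * (‖φ‖ * ‖a‖ ^ 2) := by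
      gcongr
      · exact (hsq e).trans hee
      · exact (hsq a).trans haa

omit [PartialOrder A] [StarOrderedRing A] in
theorem enorm_sub_le_dL {L : selfAdjoint A → ℝ≥0∞} (φ ψ : A → ℂ) {b : selfAdjoint A}
    (hb : L b ≤ 1) : ‖φ b - ψ b‖ₑ ≤ dL L φ ψ :=
  le_iSup (fun b : {b : selfAdjoint A // L b ≤ 1} => ‖φ (b.1 : A) - ψ (b.1 : A)‖ₑ) ⟨b, hb⟩

omit [PartialOrder A] [StarOrderedRing A] in
theorem dL_le_iff {L : selfAdjoint A → ℝ≥0∞} {φ ψ : A → ℂ} {d : ℝ≥0∞} :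
    dL L φ ψ ≤ d ↔ ∀ b : selfAdjoint A, L b ≤ 1 → ‖φ b - ψ b‖ₑ ≤ d :=
  iSup_le_iff.trans Subtype.forall

omit [PartialOrder A] [StarOrderedRing A] in
theorem enorm_sub_le_mul_dL {L : selfAdjoint A → ℝ≥0∞} (hL : IsESeminorm L)
    {φ ψ : A →L[ℂ] ℂ} (hd : dL L φ ψ ≠ ⊤) {b : selfAdjoint A} (hb : L b ≠ ⊤) :
    ‖φ b - ψ b‖ₑ ≤ L b * dL L φ ψ := by
  refine ENNReal.le_mul_of_forall_lt (.inr hd) (.inl hb) fun t ht d hd' => ?_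
  rcases eq_or_ne t ⊤ with rfl | htop
  · simp [ENNReal.top_mul (pos_of_gt hd').ne']
  refine le_trans ?_ (mul_le_mul_right hd'.le t)
  lift t to ℝ≥0 using htop
  have ht0 : t ≠ 0 := by rintro rfl; simp at ht
  have h1 : L ((t⁻¹ : ℝ) • b) ≤ 1 := by
    rw [hL.1, nnnorm_inv, NNReal.nnnorm_eq, ENNReal.coe_inv ht0]
    calc (t : ℝ≥0∞)⁻¹ * L b ≤ (t : ℝ≥0∞)⁻¹ * t := by gcongr
      _ = 1 := ENNReal.inv_mul_cancel (by simpa using ht0) ENNReal.coe_ne_top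
  have h2 := enorm_sub_le_dL φ ψ h1
  have h3 : φ b - ψ b
      = (t : ℝ) • (φ ((t⁻¹ : ℝ) • b : selfAdjoint A) - ψ ((t⁻¹ : ℝ) • b : selfAdjoint A)) := by
    have ht0' : (t : ℂ) ≠ 0 := by exact_mod_cast ht0
    simp [selfAdjoint.val_smul, map_real_smul φ φ.continuous, map_real_smul ψ ψ.continuous]
    field_simp
  rw [h3, enorm_smul]
  gcongr
  simp [enorm]

omit [PartialOrder A] [StarOrderedRing A] in
theorem le_dilup {L : selfAdjoint A → ℝ≥0∞} (f : A →⋆ₙₐ[ℂ] A) {b : selfAdjoint A}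
    (hb : L b ≤ 1) : L ⟨f b, b.2.map f⟩ ≤ dilup L f :=
  le_iSup (fun b : {b : selfAdjoint A // L b ≤ 1} => L ⟨f (b.1 : A), b.1.2.map f⟩) ⟨b, hb⟩

omit [PartialOrder A] [StarOrderedRing A] in
theorem dL_piF_le {L : selfAdjoint A → ℝ≥0∞} (hL : IsESeminorm L) {k : ℕ}
    (f : Fin k → A →⋆ₙₐ[ℂ] A) (π : Fin k → ℝ≥0)
    (hdil : ∑ i, (π i : ℝ≥0∞) * dilup L (f i) ≠ ⊤) {φ ψ : A →L[ℂ] ℂ} (hd : dL L φ ψ ≠ ⊤) :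
    dL L (piF f π φ) (piF f π ψ) ≤ (∑ i, (π i : ℝ≥0∞) * dilup L (f i)) * dL L φ ψ := by
  refine dL_le_iff.2 fun b hb => ?_
  simp only [piF, ← Finset.sum_sub_distrib, ← mul_sub]
  rw [Finset.sum_mul]
  refine (enorm_sum_le _ _).trans (Finset.sum_le_sum fun i _ => ?_)
  rw [enorm_mul, mul_assoc]
  rcases eq_or_ne (π i) 0 with h0 | h0
  · simp [h0]
  have hi : dilup L (f i) ≠ ⊤ := fun h => ENNReal.sum_ne_top.1 hdil i (Finset.mem_univ i) <| by
    rw [h, ENNReal.mul_top (by simpa using h0)]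
  have hLi := le_dilup (f i) hb
  gcongr
  · simp [enorm]
  · refine (enorm_sub_le_mul_dL hL hd (b := ⟨f i b, b.2.map (f i)⟩)
      (ne_top_of_le_ne_top hi hLi)).trans ?_
    gcongr

/-- The operator `π·F*` on continuous functionals. -/
def piFCLM {k : ℕ} (f : Fin k → A →⋆ₙₐ[ℂ] A) (π : Fin k → ℝ≥0) (φ : A →L[ℂ] ℂ) : A →L[ℂ] ℂ :=
  ∑ i, ((π i : ℝ) : ℂ) • φ.comp ⟨(f i : A →ₗ[ℂ] A), map_continuous (f i)⟩

theorem coe_piFCLM {k : ℕ} (f : Fin k → A →⋆ₙₐ[ℂ] A) (π : Fin k → ℝ≥0) (φ : A →L[ℂ] ℂ) :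
    ⇑(piFCLM f π φ) = piF f π φ := by
  ext a
  simp [piFCLM, piF]
  rfl

theorem norm_piFCLM_le {k : ℕ} (f : Fin k → A →⋆ₙₐ[ℂ] A) {π : Fin k → ℝ≥0}
    (hπ : ∑ i, π i = 1) (φ : A →L[ℂ] ℂ) : ‖piFCLM f π φ‖ ≤ ‖φ‖ := by
  refine ContinuousLinearMap.opNorm_le_bound _ (norm_nonneg _) fun a => ?_
  rw [coe_piFCLM]
  calc ‖∑ i, ((π i : ℝ) : ℂ) * φ (f i a)‖ ≤ ∑ i, (π i : ℝ) * (‖φ‖ * ‖a‖) := by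
        refine norm_sum_le_of_le _ fun i _ => ?_
        rw [norm_mul, Complex.norm_real, NNReal.norm_eq]
        gcongr
        refine (φ.le_opNorm _).trans ?_
        gcongr
        exact NonUnitalStarAlgHom.norm_apply_le (f i) a
    _ = ‖φ‖ * ‖a‖ := by
      rw [← Finset.sum_mul, ← NNReal.coe_sum, hπ, NNReal.coe_one, one_mul]

theorem piFCLM_nonneg {k : ℕ} (f : Fin k → A →⋆ₙₐ[ℂ] A) (π : Fin k → ℝ≥0) {φ : A →L[ℂ] ℂ}
    (hφ : ∀ a : A, 0 ≤ a → 0 ≤ φ a) (a : A) (ha : 0 ≤ a) : 0 ≤ piFCLM f π φ a := by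
  rw [coe_piFCLM]
  refine Finset.sum_nonneg fun i _ => mul_nonneg ?_ (hφ _ (map_nonneg (f i) ha))
  exact_mod_cast (π i).coe_nonneg

/-- For a bounded sequence of functionals, the set where the values form a Cauchy sequence is
closed. -/
theorem cauchySeq_apply_of_mem_closure {E : Type*} [NormedAddCommGroup E] [NormedSpace ℂ E]
    {ψ : ℕ → E →L[ℂ] ℂ} (hψ : ∀ n, ‖ψ n‖ ≤ 1) {s : Set E}
    (hs : ∀ b ∈ s, CauchySeq fun n => ψ n b) {a : E} (ha : a ∈ closure s) :
    CauchySeq fun n => ψ n a := by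
  refine Metric.cauchySeq_iff.2 fun ε hε => ?_
  obtain ⟨b, hbs, hab⟩ := Metric.mem_closure_iff.1 ha (ε / 3) (by positivity)
  obtain ⟨N, hN⟩ := Metric.cauchySeq_iff.1 (hs b hbs) (ε / 3) (by positivity)
  have key : ∀ n, dist (ψ n a) (ψ n b) < ε / 3 := fun n => by
    rw [dist_eq_norm, ← map_sub]
    rw [dist_eq_norm] at hab
    exact ((ψ n).le_of_opNorm_le (hψ n) _).trans_lt (by rwa [one_mul])
  refine ⟨N, fun m hm n hn => ?_⟩
  have h1 := dist_triangle4 (ψ m a) (ψ m b) (ψ n b) (ψ n a)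
  have h2 := hN m hm n hn
  have h3 := key m
  have h4 := key n
  rw [dist_comm] at h4
  linarith

omit [PartialOrder A] [StarOrderedRing A] in
theorem cauchySeq_apply_of_dense {ψ : ℕ → A →L[ℂ] ℂ} (hψ : ∀ n, ‖ψ n‖ ≤ 1)
    {D : Set (selfAdjoint A)} (hD : Dense D)
    (h : ∀ b ∈ D, CauchySeq fun n => ψ n b) (a : A) : CauchySeq fun n => ψ n a := by
  have hsa : ∀ b : selfAdjoint A, CauchySeq fun n => ψ n b := fun b =>
    cauchySeq_apply_of_mem_closure hψ (s := (↑) '' D) (by rintro _ ⟨b, hb, rfl⟩; exact h b hb)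
      (image_closure_subset_closure_image continuous_subtype_val ⟨b, hD b, rfl⟩)
  obtain ⟨x, hx⟩ := cauchySeq_tendsto_of_complete (hsa (realPart a))
  obtain ⟨y, hy⟩ := cauchySeq_tendsto_of_complete (hsa (imaginaryPart a))
  have key : (fun n => ψ n a) = fun n => ψ n (realPart a) + Complex.I * ψ n (imaginaryPart a) := by
    ext n
    conv_lhs => rw [← realPart_add_I_smul_imaginaryPart a]
    simp
  rw [key]
  exact (hx.add (hy.const_mul Complex.I)).cauchySeq

/-- If `φ₀` is a state at finite `d_L`-distance from `φ`, then `φ` has norm at least `1`. -/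
theorem IsState.one_le_norm_of_dL_ne_top {L : selfAdjoint A → ℝ≥0∞} (hL : IsECSMS L)
    {φ₀ φ : A →L[ℂ] ℂ} (hφ₀ : IsState φ₀) (hd : dL L φ₀ φ ≠ ⊤) : 1 ≤ ‖φ‖ := by
  obtain ⟨⟨ι, I, hI, hLI⟩⟩ := hL.approxUnit
  have hδ : Tendsto (fun n => ‖φ₀ (I n) - φ (I n)‖) atTop (𝓝 0) := by
    have h0 : Tendsto (fun n => L (I n) * dL L φ₀ φ) atTop (𝓝 0) := by
      simpa using ENNReal.Tendsto.mul_const hLI (.inr hd)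
    have h1 : Tendsto (fun n => ‖φ₀ (I n) - φ (I n)‖ₑ) atTop (𝓝 0) := by
      refine tendsto_of_tendsto_of_tendsto_of_le_of_le' tendsto_const_nhds h0
        (.of_forall fun _ => zero_le) ?_
      filter_upwards [hLI.eventually_lt_const ENNReal.zero_lt_top] with n hn
      exact enorm_sub_le_mul_dL hL.seminorm hd hn.ne
    simpa [Function.comp_def] using (ENNReal.tendsto_toReal ENNReal.zero_ne_top).comp h1
  have hle : ∀ a, ‖φ₀ a‖ ^ 2 ≤ ‖φ‖ * ‖a‖ ^ 2 := fun a => by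
    have hl : Tendsto (fun n => ‖φ₀ (I n * a)‖ ^ 2) atTop (𝓝 (‖φ₀ a‖ ^ 2)) :=
      (((φ₀.continuous.tendsto a).comp (hI.tendsto_mul_right a)).norm).pow 2
    have hr : Tendsto (fun n => (‖φ‖ + ‖φ₀ (I n) - φ (I n)‖) * ‖a‖ ^ 2) atTop
        (𝓝 (‖φ‖ * ‖a‖ ^ 2)) := by
      simpa using (hδ.const_add ‖φ‖).mul_const (‖a‖ ^ 2)
    refine le_of_tendsto_of_tendsto' hl hr fun n => ?_
    have h1 := norm_sq_apply_mul_le hφ₀.1 (hI.1 n) (hI.2.1 n) a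
    rw [hφ₀.2, one_mul] at h1
    refine h1.trans ?_
    gcongr
    have h2 : ‖φ (I n)‖ ≤ ‖φ‖ := φ.unit_le_opNorm _ (hI.2.1 n)
    have h3 := norm_add_le (φ (I n)) (φ₀ (I n) - φ (I n))
    rw [add_sub_cancel] at h3
    linarith
  have h1 : ‖φ₀‖ ≤ √‖φ‖ := by
    refine φ₀.opNorm_le_bound (Real.sqrt_nonneg _) fun a => ?_
    refine le_of_sq_le_sq ?_ (by positivity)
    rw [mul_pow, Real.sq_sqrt (norm_nonneg _)]
    exact hle a
  rw [hφ₀.2] at h1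
  exact Real.one_le_sqrt.1 h1

/-- Existence of self-similar states: if `dilupsum(π·F*) < 1` and some state `φ₀` is at
finite `d_L`-distance from `(π·F*)(φ₀)`, then the iterates `(π·F*)^M(φ₀)` `d_L`-converge
to a `(π·F*)`-self-similar state. -/
theorem exists_selfSimilar_state (L : selfAdjoint A → ℝ≥0∞) (hL : IsECSMS L)
    {k : ℕ} (f : Fin k → A →⋆ₙₐ[ℂ] A) (hf : ∀ i, IsProperHom (f i))
    (π : Fin k → ℝ≥0) (hπ : ∑ i, π i = 1)
    (hdil : ∑ i, (π i : ℝ≥0∞) * dilup L (f i) < 1)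
    (φ₀ : A →L[ℂ] ℂ) (hφ₀ : IsState φ₀)
    (hfin : dL L ⇑φ₀ (piF f π ⇑φ₀) < ⊤) :
    ∃ φ : A →L[ℂ] ℂ, IsState φ ∧
      Tendsto (fun M => dL L ((piF f π)^[M] ⇑φ₀) ⇑φ) atTop (𝓝 0) ∧
      ∀ a : A, φ a = piF f π ⇑φ a := by
  set c := ∑ i, (π i : ℝ≥0∞) * dilup L (f i) with hc
  set C := dL L φ₀ (piF f π φ₀) with hC
  let ψ : ℕ → A →L[ℂ] ℂ := fun M => (piFCLM f π)^[M] φ₀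
  have hψ_succ : ∀ M, ⇑(ψ (M + 1)) = piF f π (ψ M) := fun M => by
    simp only [ψ, Function.iterate_succ_apply', coe_piFCLM]
  have hψ_coe : ∀ M, (piF f π)^[M] ⇑φ₀ = ψ M := fun M => by
    induction M with
    | zero => rfl
    | succ M ih => rw [Function.iterate_succ_apply', ih, hψ_succ]
  have hψ_norm : ∀ M, ‖ψ M‖ ≤ 1 := fun M => by
    induction M with
    | zero => exact hφ₀.2.le
    | succ M ih =>
      simp only [ψ, Function.iterate_succ_apply']
      exact (norm_piFCLM_le f hπ _).trans ih
  have hψ_nonneg : ∀ M, ∀ a : A, 0 ≤ a → 0 ≤ ψ M a := fun M => by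
    induction M with
    | zero => exact hφ₀.1
    | succ M ih =>
      simp only [ψ, Function.iterate_succ_apply']
      exact piFCLM_nonneg f π ih
  have hpow_ne : ∀ M : ℕ, C * c ^ M ≠ ⊤ := fun M =>
    ENNReal.mul_ne_top hfin.ne (ENNReal.pow_ne_top hdil.ne_top)
  have hstep : ∀ M, dL L (ψ M) (ψ (M + 1)) ≤ C * c ^ M := fun M => by
    induction M with
    | zero => rw [hψ_succ]; simp [ψ, hC]
    | succ M ih =>
      rw [hψ_succ (M + 1)]
      nth_rewrite 1 [hψ_succ M]
      refine (dL_piF_le hL.seminorm f π hdil.ne_top (ne_top_of_le_ne_top (hpow_ne M) ih)).trans ?_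
      calc c * dL L (ψ M) (ψ (M + 1)) ≤ c * (C * c ^ M) := by gcongr
        _ = C * c ^ (M + 1) := by ring
  have hcauchy : ∀ b ∈ {b : selfAdjoint A | L b < ⊤}, CauchySeq fun M => ψ M b := by
    intro b hb
    refine cauchySeq_of_edist_le_geometric c (L b * C) hdil
      (ENNReal.mul_ne_top hb.ne hfin.ne) fun M => ?_
    rw [edist_eq_enorm_sub, mul_assoc]
    refine (enorm_sub_le_mul_dL hL.seminorm
      (ne_top_of_le_ne_top (hpow_ne M) (hstep M)) hb.ne).trans ?_
    gcongr
    exact hstep M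
  choose g hg using fun a => cauchySeq_tendsto_of_complete
    (cauchySeq_apply_of_dense hψ_norm hL.dense_finite hcauchy a)
  let φ : A →L[ℂ] ℂ := continuousLinearMapOfTendsto ψ (tendsto_pi_nhds.2 hg)
  have hφ : ∀ a, Tendsto (fun M => ψ M a) atTop (𝓝 (φ a)) := hg
  have hdist : ∀ M, dL L (ψ M) φ ≤ C * c ^ M / (1 - c) := fun M => by
    refine dL_le_iff.2 fun b hb => ?_
    rw [← edist_eq_enorm_sub]
    refine edist_le_of_edist_le_geometric_of_tendsto c C (fun N => ?_) (hφ b) M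
    rw [edist_eq_enorm_sub]
    exact (enorm_sub_le_dL (ψ N) (ψ (N + 1)) hb).trans (hstep N)
  have hsub : (1 - c) ≠ 0 := (tsub_pos_of_lt hdil).ne'
  refine ⟨φ, ⟨fun a ha => ?_, le_antisymm ?_ ?_⟩, ?_, fun a => ?_⟩
  · exact ge_of_tendsto' (hφ a) fun M => hψ_nonneg M a ha
  · refine φ.opNorm_le_bound zero_le_one fun a => ?_
    exact le_of_tendsto' (hφ a).norm fun M => (ψ M).le_of_opNorm_le (hψ_norm M) a
  · exact hφ₀.one_le_norm_of_dL_ne_top hL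
      (ne_top_of_le_ne_top (ENNReal.div_ne_top (hpow_ne 0) hsub) (hdist 0))
  · simp only [hψ_coe]
    refine tendsto_of_tendsto_of_tendsto_of_le_of_le tendsto_const_nhds ?_
      (fun _ => zero_le) hdist
    have h := ENNReal.Tendsto.const_mul
      (ENNReal.tendsto_pow_atTop_nhds_zero_of_lt_one hdil) (.inr hfin.ne)
    simpa using ENNReal.Tendsto.div_const h (.inr hsub)
  · refine tendsto_nhds_unique ((tendsto_add_atTop_iff_nat 1).2 (hφ a)) ?_
    simp only [hψ_succ]
    exact tendsto_finsetSum _ fun i _ => (hφ (f i a)).const_mul _
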